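/- arXiv:2005.04042 — 6 statements merged into one kernel-verified Lean document; each statement's English description precedes it below -/
import Mathlib

section
/- Let Σ = {a_1, …, a_k} and let U_j^{(i)} ⊆ {a_j}* be unary languages for i ∈ {1, …, n} and j ∈ {1, …, k}, and set L = ⋃_{i=1}^n U_1^{(i)} ⧢ ⋯ ⧢ U_k^{(i)}. Suppose for some i_0 ∈ {1, …, n} and j_0 ∈ {1, …, k} the unary language U_{j_0}^{(i_0)} is infinite. Let L' = ⋃_{i=1}^n V_1^{(i)} ⧢ ⋯ ⧢ V_k^{(i)}, where V_{j_0}^{(i_0)} = {a_{j_0}}* and V_j^{(i)} = U_j^{(i)} in all other cases. Then every deterministic complete semi-automaton A = (Σ, Q, δ) has a synchronizing word in L if and only if it has a synchronizing word in L'. -/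
/-- `Interleave u v w` holds iff `w` is obtained by interleaving (shuffling)
the words `u` and `v`, keeping the relative order of letters of each. -/
inductive Interleave {α : Type*} : List α → List α → List α → Prop
  | nil : Interleave [] [] []
  | left {a : α} {u v w : List α} : Interleave u v w → Interleave (a :: u) v (a :: w)
  | right {a : α} {u v w : List α} : Interleave u v w → Interleave u (a :: v) (a :: w)

/-- The shuffle of two languages. -/
def shuf {α : Type*} (L₁ L₂ : Set (List α)) : Set (List α) :=
  {w | ∃ u ∈ L₁, ∃ v ∈ L₂, Interleave u v w}

/-- The shuffle `U 0 ⧢ U 1 ⧢ ⋯ ⧢ U (k-1)` of a family of `k` languages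
(the shuffle operation is associative, with unit `{ε}`). -/
def shufFam {α : Type*} {k : ℕ} (U : Fin k → Set (List α)) : Set (List α) :=
  (List.finRange k).foldr (fun j acc => shuf (U j) acc) {[]}

/-- A word `w` is synchronizing for the complete deterministic semi-automaton
with transition function `δ` if all states are mapped to one common state. -/
def IsSyncWord {Q α : Type*} (δ : Q → α → Q) (w : List α) : Prop :=
  ∃ q : Q, ∀ p : Q, w.foldl δ p = q

theorem Interleave.perm {α : Type*} {u v w : List α} (h : Interleave u v w) :
    w.Perm (u ++ v) := by
  induction h with
  | nil => exact .nil
  | left _ ih => exact ih.cons _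
  | right _ ih => exact (ih.cons _).trans List.perm_middle.symm

theorem interleave_replicate_count_filter {α : Type*} [DecidableEq α] (j : α) (w : List α) :
    Interleave (List.replicate (w.count j) j) (w.filter (· ≠ j)) w := by
  induction w with
  | nil => exact .nil
  | cons a w ih =>
    by_cases h : a = j
    · subst h
      simpa [List.replicate_succ] using ih.left
    · simpa [h] using ih.right

/-- Membership in an iterated shuffle of unary languages over distinct letters depends
only on the letter counts. -/
theorem mem_foldr_shuf_iff {α : Type*} [DecidableEq α] {U : α → Set (List α)}
    (hU : ∀ j, U j ⊆ {w | ∃ m : ℕ, w = List.replicate m j}) {l : List α} (hl : l.Nodup)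
    {w : List α} :
    w ∈ l.foldr (fun j acc => shuf (U j) acc) {[]} ↔
      (∀ j ∈ l, List.replicate (w.count j) j ∈ U j) ∧ ∀ x ∈ w, x ∈ l := by
  induction l generalizing w with
  | nil => simp [List.eq_nil_iff_forall_not_mem]
  | cons j l ih =>
    obtain ⟨hj, hl⟩ := List.nodup_cons.1 hl
    rw [List.foldr_cons]
    constructor
    · rintro ⟨u, hu, v, hv, h⟩
      obtain ⟨hv, hvl⟩ := (ih hl).1 hv
      obtain ⟨m, rfl⟩ := hU j hu
      have hcount (x : α) := h.perm.count_eq x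
      simp only [List.count_append] at hcount
      refine ⟨fun x hx => ?_, fun x hx => ?_⟩
      · rw [hcount]
        rcases List.mem_cons.1 hx with rfl | hx
        · rw [List.count_eq_zero_of_not_mem fun hxv => hj (hvl _ hxv)]
          simpa using hu
        · have hne : j ≠ x := fun h => hj (h ▸ hx)
          simpa [List.count_replicate, hne] using hv x hx
      · rcases List.mem_append.1 (h.perm.mem_iff.1 hx) with hx | hx
        · simp [List.eq_of_mem_replicate hx]
        · exact List.mem_cons_of_mem _ (hvl x hx)
    · rintro ⟨hw, hwl⟩
      refine ⟨_, hw j List.mem_cons_self, w.filter (· ≠ j), (ih hl).2 ⟨fun x hx => ?_, ?_⟩,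
        interleave_replicate_count_filter j w⟩
      · have hne : x ≠ j := fun h => hj (h ▸ hx)
        rw [List.count_filter (by simpa using hne)]
        exact hw x (List.mem_cons_of_mem _ hx)
      · intro x hx
        simp only [List.mem_filter, decide_eq_true_eq] at hx
        exact (List.mem_cons.1 (hwl x hx.1)).resolve_left hx.2

theorem mem_shufFam_iff {k : ℕ} {U : Fin k → Set (List (Fin k))}
    (hU : ∀ j, U j ⊆ {w | ∃ m : ℕ, w = List.replicate m j}) {w : List (Fin k)} :
    w ∈ shufFam U ↔ ∀ j, List.replicate (w.count j) j ∈ U j := by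
  simp [shufFam, mem_foldr_shuf_iff hU (List.nodup_finRange k)]

theorem IsSyncWord.append {Q α : Type*} {δ : Q → α → Q} {w : List α} (h : IsSyncWord δ w)
    (v : List α) : IsSyncWord δ (w ++ v) := by
  obtain ⟨q, hq⟩ := h
  exact ⟨v.foldl δ q, fun p => by rw [List.foldl_append, hq]⟩

/-- An infinite unary language contains arbitrarily long words. -/
theorem exists_replicate_mem_of_infinite {α : Type*} {L : Set (List α)} {a : α}
    (hL : L ⊆ {w | ∃ m : ℕ, w = List.replicate m a}) (hinf : L.Infinite) (N : ℕ) :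
    ∃ m ≥ N, List.replicate m a ∈ L := by
  by_contra! h
  refine hinf (((Set.finite_Iio N).image fun m => List.replicate m a).subset fun w hw => ?_)
  obtain ⟨m, rfl⟩ := hL hw
  exact ⟨m, not_le.1 fun hm => h m hm hw, rfl⟩

/-- The alphabet `Σ = {a_1, …, a_k}` is modeled as `Fin k`, the letter `a_j`
being `j : Fin k`; a unary language over `a_j` is a set of words of the form
`a_j^m = List.replicate m j`. -/
theorem stmt3 {k n : ℕ} (U : Fin n → Fin k → Set (List (Fin k)))
    (hU : ∀ i j, U i j ⊆ {w | ∃ m : ℕ, w = List.replicate m j})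
    (i0 : Fin n) (j0 : Fin k) (hinf : (U i0 j0).Infinite)
    (V : Fin n → Fin k → Set (List (Fin k)))
    (hV : ∀ i j, V i j =
      if i = i0 ∧ j = j0 then {w | ∃ m : ℕ, w = List.replicate m j0} else U i j)
    (Q : Type*) [Finite Q] [Nonempty Q] (δ : Q → Fin k → Q) :
    (∃ w ∈ ⋃ i, shufFam (U i), IsSyncWord δ w) ↔
    (∃ w ∈ ⋃ i, shufFam (V i), IsSyncWord δ w) := by
  have hV' : ∀ i j, V i j ⊆ {w | ∃ m : ℕ, w = List.replicate m j} := by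
    intro i j
    rw [hV]
    split_ifs with h
    · rw [h.2]
    · exact hU i j
  simp only [Set.mem_iUnion, mem_shufFam_iff (hU _), mem_shufFam_iff (hV' _)]
  constructor
  · rintro ⟨w, ⟨i, hw⟩, hs⟩
    refine ⟨w, ⟨i, fun j => ?_⟩, hs⟩
    rw [hV]
    split_ifs with h
    · exact ⟨_, by rw [h.2]⟩
    · exact hw j
  · rintro ⟨w, ⟨i, hw⟩, hs⟩
    by_cases hi : i = i0
    · subst hi
      obtain ⟨m, hm, hmU⟩ := exists_replicate_mem_of_infinite (hU i j0) hinf (w.count j0)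
      refine ⟨w ++ List.replicate (m - w.count j0) j0, ⟨i, fun j => ?_⟩, hs.append _⟩
      by_cases hj : j = j0
      · subst hj
        simpa [Nat.add_sub_cancel' hm] using hmU
      · have h := hw j
        rw [hV, if_neg fun h => hj h.2] at h
        simpa [List.count_replicate, Ne.symm hj] using h
    · refine ⟨w, ⟨i, fun j => ?_⟩, hs⟩
      have h := hw j
      rwa [hV, if_neg fun h => hi h.1] at h
end

section
/- Let A = (Σ, Q, δ) be a deterministic complete semi-automaton over the two-letter alphabet Σ = {a, b} with n = |Q|. Then there exist i, j ≥ 0 such that |δ(Q, a^i b a^j)| = 1 if and only if there exists i with 0 ≤ i ≤ n − 1 such that |δ(Q, a^i b a^{n−1})| = 1. In other words, a synchronizing word for A of the form a^i b a^j (containing the letter b exactly once) exists if and only if one of the n words b a^{n−1}, a b a^{n−1}, …, a^{n−1} b a^{n−1} is synchronizing. -/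
open Function Set

theorem range_iterate_succ {Q : Type*} (f : Q → Q) (k : ℕ) :
    range f^[k + 1] = f '' range f^[k] := by
  rw [iterate_succ', range_comp]

theorem range_iterate_add {Q : Type*} (f : Q → Q) (m k : ℕ) :
    range f^[m + k] = f^[m] '' range f^[k] := by
  rw [iterate_add, range_comp]

theorem range_iterate_succ_subset {Q : Type*} (f : Q → Q) (k : ℕ) :
    range f^[k + 1] ⊆ range f^[k] := by
  rw [iterate_succ]
  exact range_comp_subset_range _ _

theorem range_iterate_succ_eq_or_ncard_add_le {Q : Type*} [Finite Q] (f : Q → Q) (k : ℕ) :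
    range f^[k + 1] = range f^[k] ∨ (range f^[k + 1]).ncard + (k + 1) ≤ Nat.card Q := by
  have strict (k : ℕ) (hk : range f^[k + 1] ≠ range f^[k]) :
      (range f^[k + 1]).ncard < (range f^[k]).ncard :=
    ncard_lt_ncard ((range_iterate_succ_subset f k).ssubset_of_ne hk)
  refine or_iff_not_imp_left.mpr fun hk => ?_
  have hlt := strict k hk
  induction k with
  | zero =>
    simp only [iterate_zero, range_id, ncard_univ] at hlt
    omega
  | succ k ih =>
    have hk' : range f^[k + 1] ≠ range f^[k] := fun h => hk <| by
      rw [range_iterate_succ f (k + 1), h, ← range_iterate_succ, h]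
    have := ih hk' (strict k hk')
    omega

/-- The images of the iterates of a self-map of an `n`-element set are stable from
the exponent `n - 1` on. -/
theorem range_iterate_add_card_pred {Q : Type*} [Finite Q] [Nonempty Q] (f : Q → Q) (m : ℕ) :
    range f^[m + (Nat.card Q - 1)] = range f^[Nat.card Q - 1] := by
  induction m with
  | zero => simp
  | succ m ih =>
    rw [Nat.add_right_comm, range_iterate_succ, ih, ← range_iterate_succ]
    refine (range_iterate_succ_eq_or_ncard_add_le f _).resolve_right fun h => ?_
    have : 0 < (range f^[Nat.card Q - 1 + 1]).ncard := (ncard_pos).mpr (range_nonempty _)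
    omega

/-- The kernels of the iterates of a self-map of an `n`-element set are stable from
the exponent `n - 1` on. -/
theorem iterate_card_pred_eq_of_iterate_eq {Q : Type*} [Finite Q] [Nonempty Q] (f : Q → Q)
    {j : ℕ} {x y : Q} (h : f^[j] x = f^[j] y) :
    f^[Nat.card Q - 1] x = f^[Nat.card Q - 1] y := by
  have hinj : InjOn f^[j] (range f^[Nat.card Q - 1]) :=
    injOn_of_ncard_image_eq (by rw [← range_iterate_add, range_iterate_add_card_pred])
  refine hinj (mem_range_self x) (mem_range_self y) ?_
  rw [← iterate_add_apply, ← iterate_add_apply, Nat.add_comm, iterate_add_apply, h,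
    ← iterate_add_apply]

theorem foldl_replicate_eq_iterate {Q α : Type*} (δ : Q → α → Q) (a : α) (k : ℕ) (p : Q) :
    (List.replicate k a).foldl δ p = (δ · a)^[k] p := by
  induction k generalizing p with
  | zero => rfl
  | succ k ih => simp [List.replicate_succ, ih]

theorem isSyncWord_replicate_iff {Q α : Type*} (δ : Q → α → Q) (a b : α) (i j : ℕ) :
    IsSyncWord δ (List.replicate i a ++ [b] ++ List.replicate j a) ↔
      ∃ q : Q, ∀ p : Q, (δ · a)^[j] (δ ((δ · a)^[i] p) b) = q := by
  simp only [IsSyncWord, List.foldl_append, foldl_replicate_eq_iterate, List.foldl_cons,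
    List.foldl_nil]

/-- The two-letter alphabet `Σ = {a, b}` is modeled by `Bool` together with two
distinct letters `a b : Bool`.  For a deterministic complete semi-automaton with
`n = |Q|` states, a synchronizing word of the form `a^i b a^j` exists iff one of
the `n` words `b a^{n-1}, a b a^{n-1}, …, a^{n-1} b a^{n-1}` is synchronizing. -/
theorem stmt8 {Q : Type*} [Finite Q] [Nonempty Q] (δ : Q → Bool → Q)
    (a b : Bool) (hab : a ≠ b) :
    (∃ i j : ℕ, IsSyncWord δ (List.replicate i a ++ [b] ++ List.replicate j a)) ↔
    (∃ i : ℕ, i ≤ Nat.card Q - 1 ∧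
      IsSyncWord δ (List.replicate i a ++ [b] ++ List.replicate (Nat.card Q - 1) a)) := by
  simp only [isSyncWord_replicate_iff]
  refine ⟨?_, fun ⟨i, _, h⟩ => ⟨i, _, h⟩⟩
  rintro ⟨i, j, q, hq⟩
  let p₀ : Q := Classical.arbitrary Q
  have key (p : Q) := iterate_card_pred_eq_of_iterate_eq (δ · a) ((hq p).trans (hq p₀).symm)
  rcases le_total i (Nat.card Q - 1) with hi | hi
  · exact ⟨i, hi, _, key⟩
  · refine ⟨Nat.card Q - 1, le_rfl,
      (δ · a)^[Nat.card Q - 1] (δ ((δ · a)^[i] p₀) b), fun p => ?_⟩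
    have hp : (δ · a)^[Nat.card Q - 1] p ∈ range (δ · a)^[i] := by
      rw [← Nat.sub_add_cancel hi, range_iterate_add_card_pred]
      exact mem_range_self p
    obtain ⟨p', hp'⟩ := hp
    rw [← hp']
    exact key p'
end

section
/- Let Σ = {a_1, …, a_k} and let M = (Σ, Q, δ, s_0, F) be a complete deterministic finite automaton such that L(M) is commutative. Then membership in L(M) depends only on the tuple of states reached by the unary letter-powers: for all words u, v ∈ Σ*, if δ(s_0, a_j^{|u|_{a_j}}) = δ(s_0, a_j^{|v|_{a_j}}) for every j ∈ {1, …, k}, then u ∈ L(M) if and only if v ∈ L(M). Consequently, the commutative automaton C_M — the DFA with state set the k-fold product of Q, start state (s_0, …, s_0), transition on letter a_j applying δ(·, a_j) to the j-th coordinate and fixing all other coordinates, and accepting set E = {(δ(s_0, a_1^{|w|_{a_1}}), …, δ(s_0, a_k^{|w|_{a_k}})) | w ∈ L(M)} — satisfies L(C_M) = L(M). -/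
/-- The product automaton reads each letter only in its own coordinate. -/
theorem foldl_update_apply {α Q : Type*} [DecidableEq α] (δ : Q → α → Q) (w : List α)
    (t : α → Q) (j : α) :
    w.foldl (fun (t : α → Q) (c : α) => Function.update t c (δ (t c) c)) t j =
      (List.replicate (w.count j) j).foldl δ (t j) := by
  induction w generalizing t with
  | nil => simp
  | cons c w ih =>
    rw [List.foldl_cons, ih]
    by_cases h : c = j
    · subst h
      simp [List.replicate_succ]
    · simp [h, Function.update_of_ne (Ne.symm h)]

theorem perm_replicate_count_append_filter {α : Type*} [DecidableEq α] (u : List α) (j : α) :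
    u.Perm (List.replicate (u.count j) j ++ u.filter (fun c => !(c == j))) := by
  rw [← List.filter_beq]
  exact (List.filter_append_perm (fun c => c == j) u).symm

/-- In a commutative language recognized by a DFA, the letter counts in a finite set `S` may be
changed as long as the states reached by the corresponding unary words are preserved. -/
theorem mem_iff_of_foldl_replicate_eq_on {α Q : Type*} [DecidableEq α] (δ : Q → α → Q) (s0 : Q)
    (F : Set Q)
    (hcomm : ∀ u v : List α, u.Perm v → (u.foldl δ s0 ∈ F ↔ v.foldl δ s0 ∈ F))
    (S : Finset α) (u v : List α)
    (hS : ∀ j ∈ S, (List.replicate (u.count j) j).foldl δ s0 =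
      (List.replicate (v.count j) j).foldl δ s0)
    (hSc : ∀ j ∉ S, u.count j = v.count j) :
    u.foldl δ s0 ∈ F ↔ v.foldl δ s0 ∈ F := by
  induction S using Finset.induction_on generalizing u with
  | empty => exact hcomm u v (List.perm_iff_count.2 fun j => hSc j (by simp))
  | insert j S _ ih =>
    let w := List.replicate (v.count j) j ++ u.filter (fun c => !(c == j))
    have hwj : w.count j = v.count j := by
      simp [w, List.count_eq_zero]
    have hwi : ∀ i, i ≠ j → w.count i = u.count i := by
      intro i hi
      simp [w, List.count_filter, List.count_replicate, hi, Ne.symm hi]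
    have huw : u.foldl δ s0 ∈ F ↔ w.foldl δ s0 ∈ F := by
      rw [hcomm _ _ (perm_replicate_count_append_filter u j), List.foldl_append,
        List.foldl_append, hS j (Finset.mem_insert_self j S)]
    rw [huw]
    refine ih w (fun i hi => ?_) (fun i hi => ?_)
    · by_cases hij : i = j
      · rw [hij, hwj]
      · rw [hwi i hij, hS i (Finset.mem_insert_of_mem hi)]
    · by_cases hij : i = j
      · rw [hij, hwj]
      · rw [hwi i hij, hSc i (by simp [hij, hi])]


/-- The alphabet `Σ = {a_1, …, a_k}` is modeled as `Fin k`.  A complete DFA is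
given by `δ : Q → Fin k → Q` (extended to words via `List.foldl`), start state
`s0` and final states `F`, with accepted language `L = {w | δ(s0, w) ∈ F}`.
`a_j^{|w|_{a_j}}` is `List.replicate (w.count j) j`.

If `L` is commutative, then membership in `L` only depends on the tuple of
states `(δ(s0, a_j^{|w|_{a_j}}))_j`, and consequently the commutative automaton
`C_M` — with state set `Fin k → Q`, start state `(s0, …, s0)`, transitions on
the letter `a_j` applying `δ(·, a_j)` to the `j`-th coordinate, and accepting
set `E = {(δ(s0, a_j^{|w|_{a_j}}))_j | w ∈ L}` — accepts exactly `L`. -/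
theorem stmt9 {k : ℕ} {Q : Type*} [Finite Q] (δ : Q → Fin k → Q) (s0 : Q)
    (F : Set Q) (L : Set (List (Fin k))) (hL : L = {w | w.foldl δ s0 ∈ F})
    (hcomm : ∀ u v : List (Fin k), u.Perm v → (u ∈ L ↔ v ∈ L)) :
    (∀ u v : List (Fin k),
      (∀ j : Fin k, (List.replicate (u.count j) j).foldl δ s0 =
        (List.replicate (v.count j) j).foldl δ s0) → (u ∈ L ↔ v ∈ L)) ∧
    {w : List (Fin k) |
        w.foldl (fun (t : Fin k → Q) (c : Fin k) => Function.update t c (δ (t c) c))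
          (fun _ => s0) ∈
      {t : Fin k → Q | ∃ w' ∈ L, ∀ j : Fin k,
        t j = (List.replicate (w'.count j) j).foldl δ s0}} = L := by
  subst hL
  have key : ∀ u v : List (Fin k),
      (∀ j : Fin k, (List.replicate (u.count j) j).foldl δ s0 =
        (List.replicate (v.count j) j).foldl δ s0) →
      (u ∈ {w | w.foldl δ s0 ∈ F} ↔ v ∈ {w : List (Fin k) | w.foldl δ s0 ∈ F}) := fun u v h =>
    mem_iff_of_foldl_replicate_eq_on δ s0 F hcomm Finset.univ u v (fun j _ => h j)
      (fun j hj => absurd (Finset.mem_univ j) hj)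
  refine ⟨key, Set.ext fun w => ⟨?_, fun hw => ⟨w, hw, fun j => foldl_update_apply δ w _ j⟩⟩⟩
  rintro ⟨w', hw', h⟩
  exact (key w w' fun j => (foldl_update_apply δ w _ j).symm.trans (h j)).2 hw'
end

section
/- Let Σ = {a_1, …, a_k}, let M = (Σ, Q, δ, s_0, F) be a complete deterministic finite automaton, and let s_1, …, s_k ∈ Q be states. Set U_j = {u ∈ {a_j}* | δ(s_0, u) = s_j} for j ∈ {1, …, k}. Then {w ∈ Σ* | δ(s_0, a_j^{|w|_{a_j}}) = s_j for every j ∈ {1, …, k}} = U_1 ⧢ ⋯ ⧢ U_k; that is, the set of words leading into the state (s_1, …, s_k) of the commutative automaton built from M equals the shuffle of the unary languages U_1, …, U_k. -/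
/-- Every word is an interleaving of the occurrences of `a` with the remaining letters. -/
theorem interleave_replicate_count {α : Type*} [DecidableEq α] (a : α) (w : List α) :
    Interleave (List.replicate (w.count a) a) (w.filter (· ≠ a)) w := by
  induction w with
  | nil => exact .nil
  | cons b w ih =>
    by_cases hb : b = a
    · subst hb
      simpa [List.replicate_succ] using ih.left (a := b)
    · simpa [hb] using ih.right (a := b)

/-- A word lies in the shuffle, over the distinct letters of `l`, of the unary languages
`{a ^ m | P a m}` iff it uses only letters of `l` and its letter counts satisfy `P`. -/
theorem mem_foldr_shuf_unary_iff {α : Type*} [DecidableEq α] (P : α → List α → Prop)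
    {l : List α} (hl : l.Nodup) (w : List α) :
    w ∈ l.foldr (fun a acc => shuf {u | (∃ m : ℕ, u = List.replicate m a) ∧ P a u} acc) {[]} ↔
      (∀ x ∈ w, x ∈ l) ∧ ∀ a ∈ l, P a (List.replicate (w.count a) a) := by
  induction l generalizing w with
  | nil => simp [List.eq_nil_iff_forall_not_mem]
  | cons a l ih =>
    obtain ⟨ha, hl⟩ := List.nodup_cons.1 hl
    rw [List.foldr_cons]
    constructor
    · rintro ⟨_, ⟨⟨m, rfl⟩, hP⟩, v, hv, hw⟩
      obtain ⟨hvl, hvP⟩ := (ih hl v).1 hv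
      have hp := hw.perm
      refine ⟨fun x hx => ?_, fun b hb => ?_⟩
      · rcases List.mem_append.1 (hp.mem_iff.1 hx) with h | h
        · exact List.mem_cons.2 (.inl (List.eq_of_mem_replicate h))
        · exact List.mem_cons_of_mem _ (hvl x h)
      · rw [hp.count_eq, List.count_append]
        rcases List.mem_cons.1 hb with rfl | hb
        · rw [List.count_eq_zero_of_not_mem fun h => ha (hvl _ h)]
          simpa using hP
        · have hab : a ≠ b := fun h => ha (h ▸ hb)
          simpa [List.count_replicate, hab] using hvP b hb
    · rintro ⟨hwl, hwP⟩
      refine ⟨_, ⟨⟨_, rfl⟩, hwP a List.mem_cons_self⟩, _, (ih hl _).2 ⟨fun x hx => ?_, fun b hb => ?_⟩,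
        interleave_replicate_count a w⟩
      · obtain ⟨hxw, hxa⟩ := List.mem_filter.1 hx
        exact (List.mem_cons.1 (hwl x hxw)).resolve_left (by simpa using hxa)
      · have hba : b ≠ a := fun h => ha (h ▸ hb)
        rw [List.count_filter (by simpa using hba)]
        exact hwP b (List.mem_cons_of_mem _ hb)

/-- The alphabet `Σ = {a_1, …, a_k}` is modeled as `Fin k`.  For a complete DFA
`M` with transitions `δ` and start state `s0`, and states `s_1, …, s_k`, the set
of words `w` with `δ(s0, a_j^{|w|_{a_j}}) = s_j` for all `j` — i.e. the words
leading into state `(s_1, …, s_k)` of the commutative automaton built from `M` —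
equals `U_1 ⧢ ⋯ ⧢ U_k`, where `U_j = {u ∈ {a_j}* | δ(s0, u) = s_j}`. -/
theorem stmt10 {k : ℕ} {Q : Type*} (δ : Q → Fin k → Q) (s0 : Q) (s : Fin k → Q) :
    {w : List (Fin k) | ∀ j : Fin k,
        (List.replicate (w.count j) j).foldl δ s0 = s j} =
    shufFam (fun j => {u | (∃ m : ℕ, u = List.replicate m j) ∧ u.foldl δ s0 = s j}) := by
  ext w
  have h := mem_foldr_shuf_unary_iff (fun j u => u.foldl δ s0 = s j) (List.nodup_finRange k) w
  simpa [shufFam] using h.symm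
end

section
/- Let Σ = {a_1, …, a_k} and let M = (Σ, Q, δ, s_0, F) be a complete deterministic finite automaton such that L(M) is commutative. Let E = {(δ(s_0, a_1^{|w|_{a_1}}), …, δ(s_0, a_k^{|w|_{a_k}})) | w ∈ L(M)}, a finite set of k-tuples of states, say E = {(s_1^{(l)}, …, s_k^{(l)}) | l ∈ {1, …, m}}, and set U_j^{(l)} = {u ∈ {a_j}* | δ(s_0, u) = s_j^{(l)}} for l ∈ {1, …, m} and j ∈ {1, …, k}. Then L(M) = ⋃_{l=1}^m U_1^{(l)} ⧢ ⋯ ⧢ U_k^{(l)}. -/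
theorem Interleave.filter {α : Type*} (p : α → Bool) (w : List α) :
    Interleave (w.filter p) (w.filter fun a => !p a) w := by
  induction w with
  | nil => exact .nil
  | cons a w ih =>
    cases h : p a
    · simpa [h] using ih.right
    · simpa [h] using ih.left

/-- An iterated shuffle of languages of powers of distinct letters is determined by letter counts. -/
theorem mem_foldr_shuf_replicate_iff {α : Type*} [DecidableEq α] (S : α → Set (List α))
    {l : List α} (hl : l.Nodup) (w : List α) :
    w ∈ l.foldr (fun j acc => shuf {u | (∃ m : ℕ, u = List.replicate m j) ∧ u ∈ S j} acc) {[]} ↔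
      (∀ j ∈ l, List.replicate (w.count j) j ∈ S j) ∧ ∀ a ∈ w, a ∈ l := by
  induction l generalizing w with
  | nil => simp [List.eq_nil_iff_forall_not_mem]
  | cons j l ih =>
    obtain ⟨hj, hl⟩ := List.nodup_cons.mp hl
    rw [List.foldr_cons]
    constructor
    · rintro ⟨_, ⟨⟨m, rfl⟩, hm⟩, v, hv, hw⟩
      obtain ⟨hv, hvl⟩ := (ih hl v).mp hv
      have hcount (i : α) : w.count i = (List.replicate m j).count i + v.count i := by
        rw [hw.perm.count_eq, List.count_append]
      refine ⟨fun i hi => ?_, fun a ha => ?_⟩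
      · rcases List.mem_cons.mp hi with rfl | hi
        · rw [hcount, List.count_replicate_self,
            List.count_eq_zero.mpr fun h => hj (hvl _ h)]
          exact hm
        · have hne : j ≠ i := fun h => hj (h ▸ hi)
          rw [hcount, List.count_replicate, if_neg (by simpa using hne), zero_add]
          exact hv i hi
      · rcases List.mem_append.mp (hw.perm.mem_iff.mp ha) with h | h
        · exact List.mem_cons.mpr (.inl (List.eq_of_mem_replicate h))
        · exact List.mem_cons_of_mem _ (hvl _ h)
    · rintro ⟨hw, hwl⟩
      refine ⟨w.filter (· == j), ⟨⟨w.count j, List.filter_beq j⟩, ?_⟩,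
        w.filter (fun a => !(a == j)), (ih hl _).mpr ⟨fun i hi => ?_, fun a ha => ?_⟩,
        Interleave.filter _ w⟩
      · rw [List.filter_beq]
        exact hw j List.mem_cons_self
      · have hne : i ≠ j := fun h => hj (h ▸ hi)
        rw [List.count_filter (by simpa using hne)]
        exact hw i (List.mem_cons_of_mem _ hi)
      · obtain ⟨ha, hne⟩ := List.mem_filter.mp ha
        exact (List.mem_cons.mp (hwl a ha)).resolve_left (by simpa using hne)

/-- In a commutative language, powers of letters reaching the same state may be exchanged. -/
theorem append_flatMap_replicate_mem_iff {α Q : Type*} {δ : Q → α → Q} {s0 : Q} {F : Set Q}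
    (hcomm : ∀ u v : List α, u.Perm v → (u.foldl δ s0 ∈ F ↔ v.foldl δ s0 ∈ F)) {f g : α → ℕ}
    (hfg : ∀ j, (List.replicate (f j) j).foldl δ s0 = (List.replicate (g j) j).foldl δ s0)
    (l p : List α) :
    (p ++ l.flatMap fun j => List.replicate (f j) j).foldl δ s0 ∈ F ↔
      (p ++ l.flatMap fun j => List.replicate (g j) j).foldl δ s0 ∈ F := by
  induction l generalizing p with
  | nil => rfl
  | cons j l ih =>
    have hswap (n : ℕ) (r : List α) :
        (p ++ (List.replicate n j ++ r)).Perm (List.replicate n j ++ (p ++ r)) := by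
      simpa only [List.append_assoc] using List.perm_append_comm.append_right r
    rw [List.flatMap_cons, List.flatMap_cons, hcomm _ _ (hswap _ _), List.foldl_append, hfg,
      ← List.foldl_append, ← hcomm _ _ (hswap _ _), ← List.append_assoc, ih, List.append_assoc]

theorem perm_flatMap_finRange_replicate_count {k : ℕ} (w : List (Fin k)) :
    w.Perm ((List.finRange k).flatMap fun j => List.replicate (w.count j) j) := by
  rw [List.perm_iff_count]
  intro a
  rw [List.count_flatMap, ← Fin.sum_univ_def]
  simp [List.count_replicate]

/-- The alphabet `Σ = {a_1, …, a_k}` is modeled as `Fin k`.  Let `M` be a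
complete DFA with transitions `δ`, start state `s0` and final states `F`,
accepting a commutative language `L`.  With `E` the accepting set of the
commutative automaton, i.e. the set of tuples
`(δ(s0, a_1^{|w|_{a_1}}), …, δ(s0, a_k^{|w|_{a_k}}))` for `w ∈ L`, the language
`L` is the union over all `t ∈ E` of the shuffles `U_1^{(t)} ⧢ ⋯ ⧢ U_k^{(t)}`,
where `U_j^{(t)} = {u ∈ {a_j}* | δ(s0, u) = t j}`. -/
theorem stmt11 {k : ℕ} {Q : Type*} [Finite Q] (δ : Q → Fin k → Q) (s0 : Q)
    (F : Set Q) (L : Set (List (Fin k))) (hL : L = {w | w.foldl δ s0 ∈ F})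
    (hcomm : ∀ u v : List (Fin k), u.Perm v → (u ∈ L ↔ v ∈ L)) :
    L = ⋃ t ∈ {t : Fin k → Q | ∃ w ∈ L, ∀ j : Fin k,
          t j = (List.replicate (w.count j) j).foldl δ s0},
        shufFam (fun j => {u | (∃ m : ℕ, u = List.replicate m j) ∧
          u.foldl δ s0 = t j}) := by
  have hmem (t : Fin k → Q) (w : List (Fin k)) :
      w ∈ shufFam (fun j => {u | (∃ m : ℕ, u = List.replicate m j) ∧ u.foldl δ s0 = t j}) ↔
        ∀ j, (List.replicate (w.count j) j).foldl δ s0 = t j :=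
    (mem_foldr_shuf_replicate_iff (fun j => {u | u.foldl δ s0 = t j})
      (List.nodup_finRange k) w).trans (by simp)
  subst hL
  ext w
  simp only [Set.mem_iUnion, exists_prop, hmem]
  constructor
  · exact fun hw => ⟨fun j => (List.replicate (w.count j) j).foldl δ s0,
      ⟨w, hw, fun _ => rfl⟩, fun _ => rfl⟩
  · rintro ⟨t, ⟨v, hv, hvt⟩, hwt⟩
    rw [hcomm _ _ (perm_flatMap_finRange_replicate_count w)]
    rw [hcomm _ _ (perm_flatMap_finRange_replicate_count v)] at hv
    exact (append_flatMap_replicate_mem_iff hcomm (fun j => (hvt j).symm.trans (hwt j).symm)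
      (List.finRange k) []).mp hv
end

section
/- Let Σ = {a_1, …, a_k} and for i ∈ {1, …, n}, j ∈ {1, …, k} let U_j^{(i)} ⊆ {a_j}* be nonempty unary languages, each either infinite or a singleton; let C_i = U_1^{(i)} ⧢ ⋯ ⧢ U_k^{(i)} and L = ⋃_{i=1}^n C_i. Fix i_0 ∈ {1, …, n} and suppose there is a function λ : {1, …, n} \ {i_0} → {1, …, k} such that for every i ≠ i_0 the language U_{λ(i)}^{(i)} is a singleton {a_{λ(i)}^{c_i}}, and either U_{λ(i)}^{(i_0)} is infinite, or U_{λ(i)}^{(i_0)} is a singleton {a_{λ(i)}^{d_i}} with d_i > c_i. Define m(i) = d_i if U_{λ(i)}^{(i_0)} = {a_{λ(i)}^{d_i}} is a singleton, and m(i) = c_i + 1 if U_{λ(i)}^{(i_0)} is infinite. Then every word w ∈ Σ* satisfying |w|_{a_{λ(i)}} ≥ m(i) for all i ∈ {1, …, n} \ {i_0} fulfills: w ∈ L if and only if w ∈ C_{i_0}. -/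
theorem Interleave.count_eq {α : Type*} [DecidableEq α] {u v w : List α}
    (h : Interleave u v w) (x : α) : w.count x = u.count x + v.count x := by
  induction h with
  | nil => simp
  | left _ ih => simp only [List.count_cons, ih]; omega
  | right _ ih => simp only [List.count_cons, ih]; omega

theorem count_of_mem_foldr_shuf {α : Type*} [DecidableEq α] {U : α → Set (List α)}
    (hU : ∀ j, U j ⊆ {w | ∃ m : ℕ, w = List.replicate m j}) {l : List α} (hl : l.Nodup)
    {w : List α} (hw : w ∈ l.foldr (fun j acc => shuf (U j) acc) {[]}) :
    (∀ j ∉ l, w.count j = 0) ∧ ∀ j ∈ l, List.replicate (w.count j) j ∈ U j := by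
  induction l generalizing w with
  | nil =>
    obtain rfl : w = [] := hw
    simp
  | cons a l ih =>
    obtain ⟨u, hu, v, hv, huv⟩ := hw
    obtain ⟨r, rfl⟩ := hU a hu
    obtain ⟨ha, hl⟩ := List.nodup_cons.1 hl
    obtain ⟨hout, hin⟩ := ih hl hv
    have hne : ∀ j, j ≠ a → w.count j = v.count j := fun j hj => by
      rw [huv.count_eq, List.count_replicate, if_neg (by simpa using hj.symm), zero_add]
    refine ⟨fun j hj => ?_, fun j hj => ?_⟩
    · rw [List.mem_cons, not_or] at hj
      rw [hne j hj.1, hout j hj.2]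
    · by_cases hja : j = a
      · subst hja
        rwa [huv.count_eq, hout j ha, List.count_replicate_self, add_zero]
      · rw [hne j hja]
        exact hin j ((List.mem_cons.1 hj).resolve_left hja)

theorem replicate_count_mem_of_mem_shufFam {k : ℕ} {U : Fin k → Set (List (Fin k))}
    (hU : ∀ j, U j ⊆ {w | ∃ m : ℕ, w = List.replicate m j}) {w : List (Fin k)}
    (hw : w ∈ shufFam U) (j : Fin k) : List.replicate (w.count j) j ∈ U j :=
  (count_of_mem_foldr_shuf hU (List.nodup_finRange k) hw).2 j (List.mem_finRange j)

/-- The alphabet `Σ = {a_1, …, a_k}` is modeled as `Fin k`, and the letter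
`a_j^m` is `List.replicate m j`.  With `C_i = U_1^{(i)} ⧢ ⋯ ⧢ U_k^{(i)}` and
`L = ⋃ i, C_i`: given `i0`, a choice function `lam` with, for each `i ≠ i0`,
`U_{lam i}^{(i)} = {a_{lam i}^{c i}}` a singleton and `U_{lam i}^{(i0)}` either
infinite (then `m i = c i + 1`) or a singleton `{a_{lam i}^{d}}` with `d > c i`
(then `m i = d`), every word `w` with `|w|_{a_{lam i}} ≥ m i` for all `i ≠ i0`
satisfies `w ∈ L ↔ w ∈ C_{i0}`. -/
theorem stmt14 {k n : ℕ} (U : Fin n → Fin k → Set (List (Fin k)))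
    (hU : ∀ i j, U i j ⊆ {w | ∃ m : ℕ, w = List.replicate m j})
    (hne : ∀ i j, (U i j).Nonempty)
    (hform : ∀ i j, (U i j).Infinite ∨ ∃ u, U i j = {u})
    (i0 : Fin n) (lam : Fin n → Fin k) (c m : Fin n → ℕ)
    (hsing : ∀ i, i ≠ i0 → U i (lam i) = {List.replicate (c i) (lam i)})
    (hm : ∀ i, i ≠ i0 →
      ((U i0 (lam i)).Infinite ∧ m i = c i + 1) ∨
      (∃ d : ℕ, U i0 (lam i) = {List.replicate d (lam i)} ∧ c i < d ∧ m i = d)) :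
    ∀ w : List (Fin k), (∀ i, i ≠ i0 → m i ≤ w.count (lam i)) →
      (w ∈ ⋃ i, shufFam (U i) ↔ w ∈ shufFam (U i0)) := by
  intro w hw
  refine ⟨fun h => ?_, fun h => Set.mem_iUnion.2 ⟨i0, h⟩⟩
  obtain ⟨i, hi⟩ := Set.mem_iUnion.1 h
  by_cases hii : i = i0
  · exact hii ▸ hi
  · have hmem := replicate_count_mem_of_mem_shufFam (hU i) hi (lam i)
    rw [hsing i hii, Set.mem_singleton_iff] at hmem
    have hcount : w.count (lam i) = c i := by simpa using congrArg List.length hmem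
    have hle := hw i hii
    rcases hm i hii with ⟨-, h'⟩ | ⟨d, -, hd, h'⟩ <;> omega
end
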